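/- Let β ∈ (−1, 1), μ₊, μ₋ ∈ ℝ, t > 0, x < 0 and y > 0. Then ∫₀^t f⁺(η; y) · h(t − η; −x, −μ₋) dη = ∫₀^∞ ∫₀^t h(τ; (1+β) b + y, μ₊) · h(t − τ; (1−β) b − x, −μ₋) dτ db. -/

import Mathlib

open MeasureTheory Real Set Filter

/-- The auxiliary density `h(t; x, μ) = |x| / √(2π t³) · exp(−(x + μ t)² / (2t))`. -/
noncomputable def h (t x μ : ℝ) : ℝ :=
  |x| / Real.sqrt (2 * Real.pi * t ^ 3) * Real.exp (-(x + μ * t) ^ 2 / (2 * t))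

/-- `f⁺(s; y) = ∫₀^∞ ∫₀^s h(s − τ; (1+β) b + y, μ₊) · h(τ; (1−β) b, −μ₋) dτ db`. -/
noncomputable def fplus (β μp μm s y : ℝ) : ℝ :=
  ∫ b in Ioi (0 : ℝ), ∫ τ in (0 : ℝ)..s,
    h (s - τ) ((1 + β) * b + y) μp * h τ ((1 - β) * b) (-μm)


open scoped ENNReal Topology

/-- Fundamental theorem of calculus for a nonnegative derivative, in terms of the lower Lebesgue
integral; integrability of the derivative is automatic. -/
theorem lintegral_Ioo_ofReal_of_hasDerivAt_of_tendsto {f f' : ℝ → ℝ} {a b fa fb : ℝ} (hab : a < b)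
    (hderiv : ∀ x ∈ Ioo a b, HasDerivAt f (f' x) x) (hpos : ∀ x ∈ Ioo a b, 0 ≤ f' x)
    (ha : Tendsto f (𝓝[>] a) (𝓝 fa)) (hb : Tendsto f (𝓝[<] b) (𝓝 fb)) :
    ∫⁻ x in Ioo a b, ENNReal.ofReal (f' x) = ENNReal.ofReal (fb - fa) := by
  have hcont : ContinuousOn f (Ioo a b) := fun x hx =>
    (hderiv x hx).continuousAt.continuousWithinAt
  have hint : IntegrableOn f' (Ioc a b) := by
    refine intervalIntegral.integrableOn_deriv_of_nonneg
      (continuousOn_Icc_extendFrom_Ioo hcont ha hb) (fun x hx => ?_) hpos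
    refine (hderiv x hx).congr_of_eventuallyEq ?_
    filter_upwards [Ioo_mem_nhds hx.1 hx.2] with z hz
    exact extendFrom_extends hcont z hz
  rw [← intervalIntegral.integral_eq_sub_of_hasDerivAt_of_tendsto hab hderiv
    ((intervalIntegrable_iff_integrableOn_Ioc_of_le hab.le).2 hint) ha hb,
    intervalIntegral.integral_of_le hab.le, integral_Ioc_eq_integral_Ioo]
  exact (ofReal_integral_eq_lintegral_ofReal (hint.mono_set Ioo_subset_Ioc_self)
    ((ae_restrict_mem measurableSet_Ioo).mono hpos)).symm

/-- The primitive of the Gaussian `exp (-z ^ 2 / 2)` vanishing at `0`. -/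
noncomputable def gaussianPrimitive (u : ℝ) : ℝ := ∫ z in (0 : ℝ)..u, Real.exp (-z ^ 2 / 2)

theorem hasDerivAt_gaussianPrimitive (u : ℝ) :
    HasDerivAt gaussianPrimitive (Real.exp (-u ^ 2 / 2)) u := by
  have hc : Continuous fun z : ℝ => Real.exp (-z ^ 2 / 2) := by fun_prop
  exact intervalIntegral.integral_hasDerivAt_right (hc.intervalIntegrable _ _)
    (hc.stronglyMeasurableAtFilter _ _) hc.continuousAt

theorem gaussianPrimitive_neg (u : ℝ) : gaussianPrimitive (-u) = -gaussianPrimitive u := by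
  have := intervalIntegral.integral_comp_neg (fun z => Real.exp (-z ^ 2 / 2)) (a := 0) (b := u)
  simp only [even_two, Even.neg_pow, neg_zero] at this
  rw [gaussianPrimitive, gaussianPrimitive, this, intervalIntegral.integral_symm]

theorem tendsto_gaussianPrimitive_atTop :
    Tendsto gaussianPrimitive atTop (𝓝 (√(2 * π) / 2)) := by
  have e : ∀ z : ℝ, Real.exp (-z ^ 2 / 2) = Real.exp (-(1 / 2) * z ^ 2) := fun z => by ring_nf
  have hi : IntegrableOn (fun z : ℝ => Real.exp (-z ^ 2 / 2)) (Ioi 0) := by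
    simp only [e]
    exact (integrable_exp_neg_mul_sq (by norm_num)).integrableOn
  have := intervalIntegral_tendsto_integral_Ioi (0 : ℝ) hi tendsto_id
  simp only [e] at this
  rw [integral_gaussian_Ioi, show π / (1 / 2) = 2 * π by ring] at this
  refine this.congr fun u => ?_
  simp only [gaussianPrimitive, e, id]

theorem tendsto_gaussianPrimitive_atBot :
    Tendsto gaussianPrimitive atBot (𝓝 (-(√(2 * π) / 2))) := by
  have := (tendsto_gaussianPrimitive_atTop.comp tendsto_neg_atBot_atTop).neg
  simpa [Function.comp_def, gaussianPrimitive_neg] using this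

theorem h_nonneg (t x μ : ℝ) : 0 ≤ h t x μ := by unfold h; positivity

theorem h_of_nonpos {t : ℝ} (ht : t ≤ 0) (x μ : ℝ) : h t x μ = 0 := by
  have : 2 * π * t ^ 3 ≤ 0 :=
    mul_nonpos_of_nonneg_of_nonpos (by positivity) (Odd.pow_nonpos (by decide) ht)
  simp [h, Real.sqrt_eq_zero_of_nonpos this]

theorem h_zero_drift {t x : ℝ} (ht : 0 < t) (hx : 0 < x) :
    h t x 0 = x / (√(2 * π) * √t ^ 3) * Real.exp (-x ^ 2 / (2 * t)) := by
  have : √(2 * π * t ^ 3) = √(2 * π) * √t ^ 3 := by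
    rw [Real.sqrt_mul (by positivity)]
    congr 1
    rw [Real.sqrt_eq_iff_mul_self_eq (by positivity) (by positivity)]
    calc t ^ 3 = (√t ^ 2) ^ 3 := by rw [Real.sq_sqrt ht.le]
      _ = √t ^ 3 * √t ^ 3 := by ring
  simp [h, abs_of_pos hx, this]

/-- Girsanov factorisation of the drift. -/
theorem h_eq_exp_mul (t x μ : ℝ) :
    h t x μ = Real.exp (-x * μ - μ ^ 2 * t / 2) * h t x 0 := by
  rcases le_or_gt t 0 with ht | ht
  · simp [h_of_nonpos ht]
  · rw [h, h, mul_left_comm, ← Real.exp_add]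
    congr 2
    field_simp
    ring

theorem tendsto_sqrt_div_sqrt_nhdsGT {s : ℝ} (hs : 0 < s) :
    Tendsto (fun τ => √τ / √(s - τ)) (𝓝[>] 0) (𝓝[>] 0) := by
  refine tendsto_nhdsWithin_iff.2 ⟨?_, ?_⟩
  · have : ContinuousAt (fun τ => √τ / √(s - τ)) 0 := by
      refine ContinuousAt.div (by fun_prop) (by fun_prop) ?_
      simpa using (Real.sqrt_pos.2 hs).ne'
    have h' := this.tendsto
    simp only [Real.sqrt_zero, zero_div] at h'
    exact h'.mono_left nhdsWithin_le_nhds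
  · filter_upwards [Ioo_mem_nhdsGT hs] with τ hτ
    exact div_pos (Real.sqrt_pos.2 hτ.1) (Real.sqrt_pos.2 (sub_pos.2 hτ.2))

theorem tendsto_sqrt_div_sqrt_nhdsLT {s : ℝ} (hs : 0 < s) :
    Tendsto (fun τ => √(s - τ) / √τ) (𝓝[<] s) (𝓝[>] 0) := by
  have h1 : Tendsto (fun τ => s - τ) (𝓝[<] s) (𝓝[>] 0) := by
    refine tendsto_nhdsWithin_iff.2 ⟨?_, ?_⟩
    · have : ContinuousAt (fun τ => s - τ) s := by fun_prop
      simpa using this.tendsto.mono_left nhdsWithin_le_nhds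
    · filter_upwards [self_mem_nhdsWithin] with τ hτ
      exact sub_pos.2 (mem_Iio.1 hτ)
  simpa [Function.comp_def] using (tendsto_sqrt_div_sqrt_nhdsGT hs).comp h1

/-- First passage times of driftless Brownian motion form a convolution semigroup. -/
theorem lintegral_h_zero_mul_h_zero {a c s : ℝ} (ha : 0 < a) (hc : 0 < c) (hs : 0 < s) :
    ∫⁻ τ in Ioo 0 s, ENNReal.ofReal (h τ a 0 * h (s - τ) c 0)
      = ENNReal.ofReal (h s (a + c) 0) := by
  set p := √s with hp
  have hp0 : 0 < p := Real.sqrt_pos.2 hs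
  have hps : p ^ 2 = s := Real.sq_sqrt hs.le
  set e := Real.exp (-(a + c) ^ 2 / (2 * s)) with he
  set α := (a + c) * e / (2 * π * p ^ 3) with hα
  set γ := (a - c) * e / (2 * π * p ^ 3) * Real.exp (2 * a * c / s) with hγ
  set w : ℝ → ℝ → ℝ := fun d τ => (c * (√τ / √(s - τ)) + d * (√(s - τ) / √τ)) / p with hw
  have hderiv : ∀ τ ∈ Ioo 0 s, HasDerivAt
      (fun τ => α * gaussianPrimitive (w (-a) τ) + γ * gaussianPrimitive (w a τ))
      (h τ a 0 * h (s - τ) c 0) τ := by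
    intro τ hτ
    have hτ0 := hτ.1
    have hσ0 : 0 < s - τ := sub_pos.2 hτ.2
    have hr := Real.sqrt_pos.2 hτ0
    have hq := Real.sqrt_pos.2 hσ0
    have hr2 := Real.sq_sqrt hτ0.le
    have hq2 := Real.sq_sqrt hσ0.le
    have d1 := Real.hasDerivAt_sqrt hτ0.ne'
    have d2 : HasDerivAt (fun τ => √(s - τ)) (1 / (2 * √(s - τ)) * (-1)) τ :=
      (Real.hasDerivAt_sqrt hσ0.ne').comp τ ((hasDerivAt_id τ).const_sub s)
    have dw : ∀ d, HasDerivAt (w d)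
        (p * (c * τ - d * (s - τ)) / (2 * √τ ^ 3 * √(s - τ) ^ 3)) τ := by
      intro d
      convert! ((((d1.div d2 hq.ne').const_mul c).add
        ((d2.div d1 hr.ne').const_mul d)).div_const p) using 1
      generalize √τ = r at *
      generalize √(s - τ) = q at *
      rw [← hq2, ← hr2]
      have : p ^ 2 = r ^ 2 + q ^ 2 := by linarith
      field_simp
      rw [this]
      ring
    have key := (((hasDerivAt_gaussianPrimitive (w (-a) τ)).comp τ (dw (-a))).const_mul α).add
      (((hasDerivAt_gaussianPrimitive (w a τ)).comp τ (dw a)).const_mul γ)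
    convert! key using 1
    have e1 : Real.exp (2 * a * c / s) * Real.exp (-(w a τ) ^ 2 / 2)
        = Real.exp (-(w (-a) τ) ^ 2 / 2) := by
      rw [← Real.exp_add]
      congr 1
      simp only [hw]
      generalize √τ = r at *
      generalize √(s - τ) = q at *
      rw [← hps]
      field_simp
      ring
    have e2 : Real.exp (-a ^ 2 / (2 * τ)) * Real.exp (-c ^ 2 / (2 * (s - τ)))
        = e * Real.exp (-(w (-a) τ) ^ 2 / 2) := by
      rw [← Real.exp_add, he, ← Real.exp_add]
      congr 1
      simp only [hw]
      generalize √τ = r at *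
      generalize √(s - τ) = q at *
      rw [← hq2, ← hr2]
      have : s = r ^ 2 + q ^ 2 := by linarith
      have h2 : p ^ 2 = r ^ 2 + q ^ 2 := by linarith
      rw [div_pow, h2, this]
      field_simp
      ring
    rw [h_zero_drift hτ0 ha, h_zero_drift hσ0 hc]
    rw [show ∀ A B C D : ℝ, A * C * (B * D) = A * B * (C * D) by intros; ring, e2]
    rw [hγ, mul_assoc (_ / _) (Real.exp _), ← mul_assoc (Real.exp _), e1, hα]
    have h3 : √(2 * π) ^ 2 = 2 * π := Real.sq_sqrt (by positivity)
    generalize √(2 * π) = g at *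
    generalize Real.exp (-(w (-a) τ) ^ 2 / 2) = E at *
    generalize √τ = r at *
    generalize √(s - τ) = q at *
    have hg : g ≠ 0 := by rintro rfl; have := Real.pi_pos; nlinarith
    rw [← h3, ← hps]
    field_simp
    ring
  have hpos : ∀ τ ∈ Ioo 0 s, 0 ≤ h τ a 0 * h (s - τ) c 0 := fun τ _ =>
    mul_nonneg (h_nonneg ..) (h_nonneg ..)
  have z0 := tendsto_sqrt_div_sqrt_nhdsGT hs
  have zs := tendsto_sqrt_div_sqrt_nhdsLT hs
  have i0 : Tendsto (fun τ => √(s - τ) / √τ) (𝓝[>] 0) atTop := by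
    simpa only [Pi.inv_def, inv_div] using z0.inv_tendsto_nhdsGT_zero
  have is : Tendsto (fun τ => √τ / √(s - τ)) (𝓝[<] s) atTop := by
    simpa only [Pi.inv_def, inv_div] using zs.inv_tendsto_nhdsGT_zero
  have z0' := (z0.mono_right nhdsWithin_le_nhds).const_mul c
  have wa0 : Tendsto (w a) (𝓝[>] 0) atTop :=
    (z0'.add_atTop (i0.const_mul_atTop ha)).atTop_div_const hp0
  have wna0 : Tendsto (w (-a)) (𝓝[>] 0) atBot :=
    (z0'.add_atBot (i0.const_mul_atTop_of_neg (neg_lt_zero.2 ha))).atBot_div_const hp0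
  have was : ∀ d, Tendsto (w d) (𝓝[<] s) atTop := fun d =>
    ((is.const_mul_atTop hc).atTop_add
      ((zs.mono_right nhdsWithin_le_nhds).const_mul d)).atTop_div_const hp0
  rw [lintegral_Ioo_ofReal_of_hasDerivAt_of_tendsto hs hderiv hpos
    (((tendsto_gaussianPrimitive_atBot.comp wna0).const_mul α).add
      ((tendsto_gaussianPrimitive_atTop.comp wa0).const_mul γ))
    (((tendsto_gaussianPrimitive_atTop.comp (was (-a))).const_mul α).add
      ((tendsto_gaussianPrimitive_atTop.comp (was a)).const_mul γ)),
    h_zero_drift hs (by positivity)]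
  congr 1
  rw [hα, ← he, ← hp]
  have h3 : √(2 * π) ^ 2 = 2 * π := Real.sq_sqrt (by positivity)
  generalize √(2 * π) = g at *
  have hg : g ≠ 0 := by rintro rfl; have := Real.pi_pos; nlinarith
  rw [← h3]
  field_simp
  ring

/-- The density `t ↦ h t x μ` with values in `[0, ∞]`. -/
noncomputable def hENN (x μ t : ℝ) : ℝ≥0∞ := ENNReal.ofReal (h t x μ)

theorem hENN_lt_top (x μ t : ℝ) : hENN x μ t < ∞ := ENNReal.ofReal_lt_top

@[simp] theorem toReal_hENN (x μ t : ℝ) : (hENN x μ t).toReal = h t x μ :=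
  ENNReal.toReal_ofReal (h_nonneg ..)

theorem hENN_of_nonpos {t : ℝ} (ht : t ≤ 0) (x μ : ℝ) : hENN x μ t = 0 := by
  simp [hENN, h_of_nonpos ht]

@[fun_prop]
theorem Measurable.hENN {α : Type*} [MeasurableSpace α] {f g : α → ℝ} (hf : Measurable f)
    (hg : Measurable g) (μ : ℝ) : Measurable fun a => hENN (f a) μ (g a) := by
  unfold _root_.hENN h
  fun_prop

theorem hENN_eq_mul (x μ t : ℝ) :
    hENN x μ t = ENNReal.ofReal (Real.exp (-x * μ - μ ^ 2 * t / 2)) * hENN x 0 t := by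
  rw [hENN, h_eq_exp_mul, ENNReal.ofReal_mul (Real.exp_nonneg _), hENN]

theorem lconvolution_hENN_eq_setLIntegral (a μ c ν s : ℝ) :
    (hENN a μ ⋆ₗ hENN c ν) s = ∫⁻ τ in Ioo 0 s, hENN a μ τ * hENN c ν (s - τ) := by
  rw [lconvolution_def, ← lintegral_indicator measurableSet_Ioo]
  congr 1 with τ
  rw [neg_add_eq_sub]
  by_cases hτ : τ ∈ Ioo 0 s
  · rw [indicator_of_mem hτ]
  · rw [indicator_of_notMem hτ]
    rw [mem_Ioo, not_and_or, not_lt, not_lt] at hτ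
    rcases hτ with hτ | hτ
    · rw [hENN_of_nonpos hτ, zero_mul]
    · rw [hENN_of_nonpos (sub_nonpos.2 hτ), mul_zero]

theorem lconvolution_hENN_zero {a c : ℝ} (ha : 0 < a) (hc : 0 < c) (s : ℝ) :
    (hENN a 0 ⋆ₗ hENN c 0) s = hENN (a + c) 0 s := by
  rw [lconvolution_hENN_eq_setLIntegral]
  rcases le_or_gt s 0 with hs | hs
  · simp [hENN_of_nonpos hs, Ioo_eq_empty hs.not_gt]
  · rw [hENN, ← lintegral_h_zero_mul_h_zero ha hc hs]
    simp only [hENN, ENNReal.ofReal_mul (h_nonneg ..)]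

/-- First passage times of Brownian motion with drift form a convolution semigroup. -/
theorem lconvolution_hENN {a c : ℝ} (ha : 0 < a) (hc : 0 < c) (μ : ℝ) :
    hENN a μ ⋆ₗ hENN c μ = hENN (a + c) μ := by
  ext s
  rw [hENN_eq_mul, ← lconvolution_hENN_zero ha hc, lconvolution_def, lconvolution_def,
    ← lintegral_const_mul _ (by fun_prop)]
  congr 1 with τ
  rw [hENN_eq_mul a μ, hENN_eq_mul c μ, mul_mul_mul_comm, ← ENNReal.ofReal_mul (Real.exp_nonneg _),
    ← Real.exp_add]
  congr 3
  ring

theorem lconvolution_hENN_le {a c : ℝ} (ha : 0 < a) (hc : 0 < c) (μ ν s : ℝ) :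
    (hENN a μ ⋆ₗ hENN c ν) s
      ≤ ENNReal.ofReal (Real.exp (|μ| * a + |ν| * c)) * hENN (a + c) 0 s := by
  rw [← lconvolution_hENN_zero ha hc, lconvolution_hENN_eq_setLIntegral,
    lconvolution_hENN_eq_setLIntegral, ← lintegral_const_mul _ (by fun_prop)]
  refine setLIntegral_mono (by fun_prop) fun τ hτ => ?_
  rw [hENN_eq_mul a μ, hENN_eq_mul c ν, mul_mul_mul_comm, ← ENNReal.ofReal_mul (Real.exp_nonneg _),
    ← Real.exp_add]
  refine mul_le_mul' (ENNReal.ofReal_le_ofReal (Real.exp_le_exp.2 ?_)) le_rfl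
  have h1 := mul_nonneg (sq_nonneg μ) hτ.1.le
  have h2 := mul_nonneg (sq_nonneg ν) (sub_pos.2 hτ.2).le
  have h3 := mul_le_mul_of_nonneg_left (neg_abs_le μ) ha.le
  have h4 := mul_le_mul_of_nonneg_left (neg_abs_le ν) hc.le
  linarith

theorem lconvolution_hENN_lt_top {a c : ℝ} (ha : 0 < a) (hc : 0 < c) (μ ν s : ℝ) :
    (hENN a μ ⋆ₗ hENN c ν) s < ∞ :=
  (lconvolution_hENN_le ha hc μ ν s).trans_lt
    (ENNReal.mul_lt_top ENNReal.ofReal_lt_top (hENN_lt_top ..))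

theorem intervalIntegral_h_mul_h (a μ c ν : ℝ) {s : ℝ} (hs : 0 ≤ s) :
    ∫ τ in (0 : ℝ)..s, h τ a μ * h (s - τ) c ν = ((hENN a μ ⋆ₗ hENN c ν) s).toReal := by
  rw [lconvolution_hENN_eq_setLIntegral, intervalIntegral.integral_of_le hs,
    integral_Ioc_eq_integral_Ioo, ← integral_toReal (by fun_prop)]
  · simp
  · exact Eventually.of_forall fun τ => ENNReal.mul_lt_top (hENN_lt_top ..)
      (hENN_lt_top ..)

theorem setLIntegral_lconvolution_hENN_lt_top {β y s : ℝ} (hβ : β ∈ Ioo (-1 : ℝ) 1) (hy : 0 < y)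
    (hs : 0 < s) (μ ν : ℝ) :
    ∫⁻ b in Ioi 0, (hENN ((1 + β) * b + y) μ ⋆ₗ hENN ((1 - β) * b) ν) s < ∞ := by
  set L := |μ| + |ν|
  set C := Real.exp (s * (L + 2) ^ 2 / 2) / (√(2 * π) * √s ^ 3)
  have hi : IntegrableOn (fun b : ℝ => C * Real.exp (-2 * b)) (Ioi 0) :=
    (integrableOn_exp_mul_Ioi (by norm_num) 0).const_mul C
  refine lt_of_le_of_lt (setLIntegral_mono
    (g := fun b => ENNReal.ofReal (C * Real.exp (-2 * b))) (by fun_prop) fun b hb => ?_)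
    hi.lintegral_lt_top
  have hb : 0 < b := hb
  have ha : 0 < (1 + β) * b + y := by nlinarith [hβ.1, mul_pos (neg_lt_iff_pos_add'.1 hβ.1) hb]
  have hc : 0 < (1 - β) * b := mul_pos (sub_pos.2 hβ.2) hb
  refine (lconvolution_hENN_le ha hc μ ν s).trans ?_
  rw [hENN, ← ENNReal.ofReal_mul (Real.exp_nonneg _), h_zero_drift hs (by positivity)]
  refine ENNReal.ofReal_le_ofReal ?_
  have h3 : ((1 + β) * b + y) + (1 - β) * b = 2 * b + y := by ring
  generalize (1 + β) * b + y = a at *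
  generalize (1 - β) * b = c at *
  have hz : a + c ≤ Real.exp (a + c) := by linarith [Real.add_one_le_exp (a + c)]
  calc Real.exp (|μ| * a + |ν| * c) * ((a + c) / (√(2 * π) * √s ^ 3)
        * Real.exp (-(a + c) ^ 2 / (2 * s)))
      ≤ Real.exp (L * (a + c)) * (Real.exp (a + c) / (√(2 * π) * √s ^ 3)
        * Real.exp (-(a + c) ^ 2 / (2 * s))) := by
        gcongr
        have := mul_nonneg (abs_nonneg μ) hc.le
        have := mul_nonneg (abs_nonneg ν) ha.le
        simp only [L]
        linarith
    _ = Real.exp (L * (a + c) + (a + c) + -(a + c) ^ 2 / (2 * s)) / (√(2 * π) * √s ^ 3) := by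
        rw [Real.exp_add (L * (a + c) + (a + c)), Real.exp_add (L * (a + c))]
        ring
    _ ≤ Real.exp (s * (L + 2) ^ 2 / 2 + -2 * b) / (√(2 * π) * √s ^ 3) := by
        refine div_le_div_of_nonneg_right (Real.exp_le_exp.2 ?_) (by positivity)
        have h1 : 0 ≤ (a + c - s * (L + 2)) ^ 2 / (2 * s) := by positivity
        have h2 : (a + c - s * (L + 2)) ^ 2 / (2 * s)
            = -(-(a + c) ^ 2 / (2 * s)) - (L + 2) * (a + c) + s * (L + 2) ^ 2 / 2 := by
          field_simp
          ring
        linarith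
    _ = C * Real.exp (-2 * b) := by
        rw [Real.exp_add]
        ring

theorem measurable_lconvolution_hENN {α : Type*} [MeasurableSpace α] {f g k : α → ℝ}
    (hf : Measurable f) (hg : Measurable g) (hk : Measurable k) (μ ν : ℝ) :
    Measurable fun p => (hENN (f p) μ ⋆ₗ hENN (g p) ν) (k p) := by
  simp only [lconvolution_def]
  refine Measurable.lintegral_prod_right'
    (f := fun q : α × ℝ => hENN (f q.1) μ q.2 * hENN (g q.1) ν (-q.2 + k q.1)) ?_
  fun_prop

theorem fplus_eq_toReal {β y s : ℝ} (hβ : β ∈ Ioo (-1 : ℝ) 1) (hy : 0 < y) (hs : 0 < s)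
    (μp μm : ℝ) :
    fplus β μp μm s y = (∫⁻ b in Ioi 0,
      (hENN ((1 + β) * b + y) μp ⋆ₗ hENN ((1 - β) * b) (-μm)) s).toReal := by
  rw [fplus, ← integral_toReal]
  · congr 1 with b
    rw [← intervalIntegral_h_mul_h _ _ _ _ hs.le]
    have := intervalIntegral.integral_comp_sub_left
      (fun τ => h τ ((1 + β) * b + y) μp * h (s - τ) ((1 - β) * b) (-μm)) (a := 0) (b := s) s
    simpa using this
  · exact (measurable_lconvolution_hENN (by fun_prop) (by fun_prop) (by fun_prop) ..).aemeasurable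
  · exact ae_lt_top (measurable_lconvolution_hENN (by fun_prop) (by fun_prop) (by fun_prop) ..)
      (setLIntegral_lconvolution_hENN_lt_top hβ hy hs ..).ne

/-- Convolution identity used for the transition density with start `x < 0`, `y > 0`. -/
theorem fplus_convolution_neg (β μp μm t x y : ℝ)
    (hβ : β ∈ Ioo (-1 : ℝ) 1) (ht : 0 < t) (hx : x < 0) (hy : 0 < y) :
    ∫ η in (0 : ℝ)..t, fplus β μp μm η y * h (t - η) (-x) (-μm)
      = ∫ b in Ioi (0 : ℝ), ∫ τ in (0 : ℝ)..t,
          h τ ((1 + β) * b + y) μp * h (t - τ) ((1 - β) * b - x) (-μm) := by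
  set P : ℝ → ℝ → ℝ≥0∞ := fun b => hENN ((1 + β) * b + y) μp with hP
  set Q : ℝ → ℝ → ℝ≥0∞ := fun b => hENN ((1 - β) * b) (-μm) with hQ
  set X : ℝ → ℝ≥0∞ := hENN (-x) (-μm) with hX
  have hPQ : Measurable fun p : ℝ × ℝ => (P p.2 ⋆ₗ Q p.2) p.1 :=
    measurable_lconvolution_hENN (by fun_prop) (by fun_prop) (by fun_prop) ..
  have hXm : Measurable fun η => X (t - η) := by fun_prop
  have hJm : Measurable fun η => ∫⁻ b in Ioi 0, (P b ⋆ₗ Q b) η := hPQ.lintegral_prod_right'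
  have hL : ∫ η in (0 : ℝ)..t, fplus β μp μm η y * h (t - η) (-x) (-μm)
      = (∫⁻ η in Ioc 0 t, (∫⁻ b in Ioi 0, (P b ⋆ₗ Q b) η) * X (t - η)).toReal := by
    rw [intervalIntegral.integral_of_le ht.le, ← integral_toReal]
    · refine setIntegral_congr_fun measurableSet_Ioc fun η hη => ?_
      simp [fplus_eq_toReal hβ hy hη.1, hP, hQ, hX]
    · exact (hJm.mul hXm).aemeasurable
    · filter_upwards [ae_restrict_mem measurableSet_Ioc] with η hη
      exact ENNReal.mul_lt_top (setLIntegral_lconvolution_hENN_lt_top hβ hy hη.1 ..)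
        (hENN_lt_top ..)
  have hpos : ∀ b ∈ Ioi (0 : ℝ), 0 < (1 + β) * b + y ∧ 0 < (1 - β) * b := fun b hb =>
    ⟨add_pos (mul_pos (by linarith [hβ.1]) hb) hy, mul_pos (by linarith [hβ.2]) hb⟩
  have hR : ∫ b in Ioi (0 : ℝ), ∫ τ in (0 : ℝ)..t,
        h τ ((1 + β) * b + y) μp * h (t - τ) ((1 - β) * b - x) (-μm)
      = (∫⁻ b in Ioi 0, (P b ⋆ₗ hENN ((1 - β) * b - x) (-μm)) t).toReal := by
    rw [← integral_toReal]
    · simp only [intervalIntegral_h_mul_h _ _ _ _ ht.le, hP]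
    · exact (measurable_lconvolution_hENN (by fun_prop) (by fun_prop) (by fun_prop) ..).aemeasurable
    · filter_upwards [ae_restrict_mem measurableSet_Ioi] with b hb
      exact lconvolution_hENN_lt_top (hpos b hb).1 (by linarith [(hpos b hb).2]) ..
  rw [hL, hR]
  congr 1
  calc ∫⁻ η in Ioc 0 t, (∫⁻ b in Ioi 0, (P b ⋆ₗ Q b) η) * X (t - η)
      = ∫⁻ η in Ioc 0 t, ∫⁻ b in Ioi 0, (P b ⋆ₗ Q b) η * X (t - η) := by
        congr 1 with η
        exact (lintegral_mul_const _ (hPQ.comp measurable_prodMk_left)).symm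
    _ = ∫⁻ b in Ioi 0, ∫⁻ η in Ioc 0 t, (P b ⋆ₗ Q b) η * X (t - η) :=
        lintegral_lintegral_swap (hPQ.mul (hXm.comp measurable_fst)).aemeasurable
    _ = ∫⁻ b in Ioi 0, (P b ⋆ₗ hENN ((1 - β) * b - x) (-μm)) t := by
        refine setLIntegral_congr_fun measurableSet_Ioi fun b hb => ?_
        have hsemi : hENN ((1 - β) * b - x) (-μm) = Q b ⋆ₗ X := by
          rw [lconvolution_hENN (hpos b hb).2 (neg_pos.2 hx), sub_eq_add_neg]
        have hPm : Measurable (P b) := by fun_prop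
        have hQm : Measurable (Q b) := by fun_prop
        have hXm' : Measurable X := by fun_prop
        rw [hsemi, lconvolution_assoc hPm hQm hXm', lconvolution_def,
          ← lintegral_indicator measurableSet_Ioc]
        congr 1 with η
        rw [neg_add_eq_sub]
        by_cases hη : η ∈ Ioc 0 t
        · rw [indicator_of_mem hη]
        · rw [indicator_of_notMem hη]
          rw [mem_Ioc, not_and_or, not_lt, not_le] at hη
          rcases hη with hη | hη
          · simp only [hP, hQ]
            rw [lconvolution_hENN_eq_setLIntegral, Ioo_eq_empty hη.not_gt]
            simp
          · simp only [hX]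
            rw [hENN_of_nonpos (sub_nonpos.2 hη.le), mul_zero]
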